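/- For k = 1, …, N let ψ_k = cos(χ_k)·e₀ + sin(χ_k)·e₁ ∈ ℂ² with χ_k ∈ ℝ, let ψ = ψ₁ ⊗ ⋯ ⊗ ψ_N ∈ (ℂ²)^{⊗N}, ρ = |ψ⟩⟨ψ|, and let ρ̄ = Σ_s P_s ρ P_s be the dephasing of ρ in the product standard basis. If there exists c > 0 such that sin²(2χ_k) ≥ c for every k, then Tr(ρ̄²) ≤ (1 − c/2)^N; in particular the dephased purity decays exponentially in the number N of modes. -/

import Mathlib

open scoped InnerProductSpace

/-- The rank-one operator `|ψ⟩⟨ψ|`. -/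
noncomputable def ketbra {V : Type*} [NormedAddCommGroup V] [InnerProductSpace ℂ V]
    (ψ : V) : V →L[ℂ] V :=
  (innerSL ℂ ψ).smulRight ψ

open scoped ComplexConjugate

theorem ketbra_apply {V : Type*} [NormedAddCommGroup V] [InnerProductSpace ℂ V] (ψ v : V) :
    ketbra ψ v = inner ℂ ψ v • ψ := by
  simp [ketbra]

/-- The dephasing of `|ψ⟩⟨ψ|` in the standard basis is diagonal with entries `|ψ t|²`. -/
theorem dephased_ketbra_apply {ι : Type*} [Fintype ι] [DecidableEq ι]
    (ψ v : EuclideanSpace ℂ ι) (t : ι) :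
    (∑ s, ketbra (EuclideanSpace.single s (1 : ℂ)) * ketbra ψ *
      ketbra (EuclideanSpace.single s (1 : ℂ)) :
        EuclideanSpace ℂ ι →L[ℂ] EuclideanSpace ℂ ι) v t = (‖ψ t‖ ^ 2 : ℝ) * v t := by
  have h : ψ t * conj (ψ t) = ((‖ψ t‖ ^ 2 : ℝ) : ℂ) := by
    simp [Complex.mul_conj']
  rw [← h]
  simp [ketbra_apply, EuclideanSpace.inner_single_left, EuclideanSpace.inner_single_right,
    Pi.single_apply]
  ring

/-- The purity of the dephasing of `|ψ⟩⟨ψ|` in the standard basis is `∑ₜ |ψ t|⁴`. -/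
theorem trace_dephased_ketbra_sq {ι : Type*} [Fintype ι] [DecidableEq ι]
    (ψ : EuclideanSpace ℂ ι) (ρbar : EuclideanSpace ℂ ι →L[ℂ] EuclideanSpace ℂ ι)
    (h : ρbar = ∑ s, ketbra (EuclideanSpace.single s (1 : ℂ)) * ketbra ψ *
      ketbra (EuclideanSpace.single s (1 : ℂ))) :
    LinearMap.trace ℂ (EuclideanSpace ℂ ι)
      ((ρbar * ρbar : EuclideanSpace ℂ ι →L[ℂ] EuclideanSpace ℂ ι) :
        EuclideanSpace ℂ ι →ₗ[ℂ] EuclideanSpace ℂ ι) = ((∑ t, ‖ψ t‖ ^ 4 : ℝ) : ℂ) := by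
  have happ (v : EuclideanSpace ℂ ι) (t : ι) : ρbar v t = (‖ψ t‖ ^ 2 : ℝ) * v t := by
    rw [h, dephased_ketbra_apply]
  rw [LinearMap.trace_eq_sum_inner _ (EuclideanSpace.basisFun ι ℂ), Complex.ofReal_sum]
  refine Finset.sum_congr rfl fun t _ => ?_
  simp [EuclideanSpace.inner_single_left, happ]
  ring

theorem Real.cos_pow_four_add_sin_pow_four (x : ℝ) :
    Real.cos x ^ 4 + Real.sin x ^ 4 = 1 - Real.sin (2 * x) ^ 2 / 2 := by
  rw [Real.sin_two_mul]
  linear_combination (Real.sin x ^ 2 + Real.cos x ^ 2 + 1) * Real.sin_sq_add_cos_sq x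

/-- For the product state `ψ = ⊗ₖ (cos χₖ e₀ + sin χₖ e₁)` of `N` qubits (realized
concretely on `EuclideanSpace ℂ (Fin N → Fin 2)`), if `sin²(2χₖ) ≥ c > 0` for every `k`,
then the purity of the state dephased in the product basis is at most `(1 − c/2)^N`:
the dephased purity decays exponentially in the number of modes. -/
theorem dephased_purity_product_state_exponential_decay
    (N : ℕ) (χ : Fin N → ℝ)
    (ψ : EuclideanSpace ℂ (Fin N → Fin 2))
    (hψ : ∀ s : Fin N → Fin 2,
      ψ s = ((∏ k, (if s k = 0 then Real.cos (χ k) else Real.sin (χ k)) : ℝ) : ℂ))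
    (P : (Fin N → Fin 2) →
      (EuclideanSpace ℂ (Fin N → Fin 2) →L[ℂ] EuclideanSpace ℂ (Fin N → Fin 2)))
    (hP : ∀ s, P s = ketbra (EuclideanSpace.single s (1 : ℂ)))
    (ρ : EuclideanSpace ℂ (Fin N → Fin 2) →L[ℂ] EuclideanSpace ℂ (Fin N → Fin 2))
    (hρ : ρ = ketbra ψ)
    (ρbar : EuclideanSpace ℂ (Fin N → Fin 2) →L[ℂ] EuclideanSpace ℂ (Fin N → Fin 2))
    (hρbar : ρbar = ∑ s, P s * ρ * P s)
    (c : ℝ) (hc : 0 < c)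
    (hsin : ∀ k, c ≤ Real.sin (2 * χ k) ^ 2) :
    (LinearMap.trace ℂ (EuclideanSpace ℂ (Fin N → Fin 2))
        ((ρbar * ρbar :
            EuclideanSpace ℂ (Fin N → Fin 2) →L[ℂ] EuclideanSpace ℂ (Fin N → Fin 2)) :
          EuclideanSpace ℂ (Fin N → Fin 2) →ₗ[ℂ] EuclideanSpace ℂ (Fin N → Fin 2))).re ≤
      (1 - c / 2) ^ N := by
  subst hρ hρbar
  simp only [hP]
  rw [trace_dephased_ketbra_sq ψ _ rfl, Complex.ofReal_re]
  have hsum : ∑ s, ‖ψ s‖ ^ 4 = ∏ k, (Real.cos (χ k) ^ 4 + Real.sin (χ k) ^ 4) := by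
    calc ∑ s, ‖ψ s‖ ^ 4
        = ∑ s : Fin N → Fin 2,
            ∏ k, (if s k = 0 then Real.cos (χ k) else Real.sin (χ k)) ^ 4 := by
          refine Finset.sum_congr rfl fun s _ => ?_
          rw [hψ, Complex.norm_real, Real.norm_eq_abs, Even.pow_abs (by decide),
            Finset.prod_pow]
      _ = ∏ k, ∑ j : Fin 2, (if j = 0 then Real.cos (χ k) else Real.sin (χ k)) ^ 4 :=
          (Fintype.prod_sum fun k (j : Fin 2) =>
            (if j = 0 then Real.cos (χ k) else Real.sin (χ k)) ^ 4).symm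
      _ = ∏ k, (Real.cos (χ k) ^ 4 + Real.sin (χ k) ^ 4) := by
          simp [Fin.sum_univ_two]
  rw [hsum]
  calc ∏ k, (Real.cos (χ k) ^ 4 + Real.sin (χ k) ^ 4)
      ≤ ∏ _k : Fin N, (1 - c / 2) := by
        refine Finset.prod_le_prod (fun k _ => by positivity) fun k _ => ?_
        rw [Real.cos_pow_four_add_sin_pow_four]
        linarith [hsin k]
    _ = (1 - c / 2) ^ N := by simp
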